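/- Exact values for the R_x family: for every θ ∈ (0, π), the two-qubit state ρ_θ = |ψ_θ⟩⟨ψ_θ| with |ψ_θ⟩ = cos(θ/2)|00⟩ − i·sin(θ/2)|11⟩ satisfies C(ρ_θ) = (1/2)(|sin θ| + |cos θ| − 1) and Γ(ρ_θ) = |sin θ| + |cos θ|; in particular Γ(ρ_θ) − 1 = 2·C(ρ_θ), so the tightness ratio κ(ρ_θ) = (Γ(ρ_θ) − 1)/C(ρ_θ) equals 2 whenever C(ρ_θ) > 0 (i.e. θ ≠ π/2). -/

import Mathlib

open Matrix Kronecker Finset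
open scoped ComplexOrder

noncomputable section

def PX : Matrix (Fin 2) (Fin 2) ℂ := !![0, 1; 1, 0]
def PY : Matrix (Fin 2) (Fin 2) ℂ := !![0, -Complex.I; Complex.I, 0]
def PZ : Matrix (Fin 2) (Fin 2) ℂ := !![1, 0; 0, -1]

/-- The single-qubit phase-point operator `A_{(q,p)}`. -/
def A1 (a : ZMod 2 × ZMod 2) : Matrix (Fin 2) (Fin 2) ℂ :=
  (1 / 2 : ℂ) • ((1 : Matrix (Fin 2) (Fin 2) ℂ)
    + ((-1 : ℂ) ^ a.2.val) • PX
    + ((-1 : ℂ) ^ (a.1.val + a.2.val)) • PY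
    + ((-1 : ℂ) ^ a.1.val) • PZ)

def pauli : Fin 4 → Matrix (Fin 2) (Fin 2) ℂ := ![1, PX, PY, PZ]

/-- A density matrix: positive semidefinite with unit trace. -/
def IsDensity {d : ℕ} (ρ : Matrix (Fin d) (Fin d) ℂ) : Prop :=
  ρ.PosSemidef ∧ ρ.trace = 1

/-- Kronecker product of 2×2 matrices as a 4×4 matrix. -/
def kron2 (M N : Matrix (Fin 2) (Fin 2) ℂ) : Matrix (Fin 4) (Fin 4) ℂ :=
  Matrix.reindex (finProdFinEquiv.trans (finCongr (by norm_num)))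
    (finProdFinEquiv.trans (finCongr (by norm_num))) (M ⊗ₖ N)

/-- The two-qubit phase-point operator `A_α = A_{α₁} ⊗ A_{α₂}`. -/
def A2 (α : (ZMod 2 × ZMod 2) × (ZMod 2 × ZMod 2)) : Matrix (Fin 4) (Fin 4) ℂ :=
  kron2 (A1 α.1) (A1 α.2)

/-- The two-qubit Pauli group `P₂`. -/
def Pauli2 : Set (Matrix (Fin 4) (Fin 4) ℂ) :=
  { M | ∃ (k : Fin 4) (P Q : Fin 4), M = Complex.I ^ (k : ℕ) • kron2 (pauli P) (pauli Q) }

/-- `S` is an abelian subgroup of `P₂` with `|S| = 4` and `-I ∉ S`. -/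
def IsStabGroup2 (S : Finset (Matrix (Fin 4) (Fin 4) ℂ)) : Prop :=
  (∀ g ∈ S, g ∈ Pauli2) ∧ (1 : Matrix (Fin 4) (Fin 4) ℂ) ∈ S ∧
  (∀ g ∈ S, ∀ h ∈ S, g * h ∈ S ∧ g * h = h * g) ∧
  S.card = 4 ∧ (-1 : Matrix (Fin 4) (Fin 4) ℂ) ∉ S

/-- The pure two-qubit stabilizer states. -/
def Stab2 : Set (Matrix (Fin 4) (Fin 4) ℂ) :=
  { σ | ∃ S : Finset (Matrix (Fin 4) (Fin 4) ℂ),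
      IsStabGroup2 S ∧ σ = (4 : ℂ)⁻¹ • ∑ g ∈ S, g }

/-- Two-qubit discrete Wigner function (of any 4×4 matrix). -/
def W2 (ρ : Matrix (Fin 4) (Fin 4) ℂ) (α : (ZMod 2 × ZMod 2) × (ZMod 2 × ZMod 2)) : ℝ :=
  ((4 : ℂ)⁻¹ * (ρ * A2 α).trace).re

/-- Two-qubit free Wigner polytope. -/
def WFree2 : Set (((ZMod 2 × ZMod 2) × (ZMod 2 × ZMod 2)) → ℝ) :=
  convexHull ℝ { w | ∃ σ ∈ Stab2, w = W2 σ }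

/-- Two-qubit Wigner distance `C(ρ)`. -/
def C2 (ρ : Matrix (Fin 4) (Fin 4) ℂ) : ℝ :=
  sInf { d | ∃ f ∈ WFree2, d = ∑ α, |W2 ρ α - f α| }

/-- Two-qubit stabilizer extent `Γ(ρ)`. -/
def Gam2 (ρ : Matrix (Fin 4) (Fin 4) ℂ) : ℝ :=
  sInf { t | ∃ (k : ℕ) (a : Fin k → ℝ) (s : Fin k → Matrix (Fin 4) (Fin 4) ℂ),
      (∀ i, s i ∈ Stab2) ∧ ρ = ∑ i, a i • s i ∧ t = ∑ i, |a i| }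

/-- Rank-one projection `|ψ⟩⟨ψ|`. -/
def proj (ψ : Fin 4 → ℂ) : Matrix (Fin 4) (Fin 4) ℂ :=
  Matrix.vecMulVec ψ fun j => (starRingEnd ℂ) (ψ j)

/-- The basis vector `|00⟩`. -/
def e0 : Fin 4 → ℂ := fun i => if i = 0 then 1 else 0

/-- The basis vector `|11⟩`. -/
def e3 : Fin 4 → ℂ := fun i => if i = 3 then 1 else 0

/-- `|ψ_θ⟩ = cos(θ/2)|00⟩ + sin(θ/2)|11⟩` (the R_y family). -/
def psiRy (θ : ℝ) : Fin 4 → ℂ := fun i =>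
  if i = 0 then ((Real.cos (θ / 2) : ℝ) : ℂ)
  else if i = 3 then ((Real.sin (θ / 2) : ℝ) : ℂ) else 0

/-- `|ψ_θ⟩ = cos(θ/2)|00⟩ − i sin(θ/2)|11⟩` (the R_x family). -/
def psiRx (θ : ℝ) : Fin 4 → ℂ := fun i =>
  if i = 0 then ((Real.cos (θ / 2) : ℝ) : ℂ)
  else if i = 3 then -Complex.I * ((Real.sin (θ / 2) : ℝ) : ℂ) else 0

/-- `|Φ_θ⟩ = (1/√2)(|00⟩ + e^{iθ}|11⟩)` (the Bell+R_z family). -/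
def psiB (θ : ℝ) : Fin 4 → ℂ := fun i =>
  if i = 0 then (((Real.sqrt 2 : ℝ) : ℂ))⁻¹
  else if i = 3 then Complex.exp (θ * Complex.I) / ((Real.sqrt 2 : ℝ) : ℂ) else 0

/-- `|+_L⟩ = (1/√2)(|00⟩ + |11⟩)`. -/
def pPlus : Fin 4 → ℂ := fun i =>
  if i = 0 then (((Real.sqrt 2 : ℝ) : ℂ))⁻¹
  else if i = 3 then (((Real.sqrt 2 : ℝ) : ℂ))⁻¹ else 0

/-- `|−_L⟩ = (1/√2)(|00⟩ − |11⟩)`. -/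
def pMinus : Fin 4 → ℂ := fun i =>
  if i = 0 then (((Real.sqrt 2 : ℝ) : ℂ))⁻¹
  else if i = 3 then -(((Real.sqrt 2 : ℝ) : ℂ))⁻¹ else 0

/-- The two-qubit Pauli operator `P_i ⊗ P_j`. -/
def pauli2 (i j : Fin 4) : Matrix (Fin 4) (Fin 4) ℂ := kron2 (pauli i) (pauli j)

/-- The sign with which `pauli i` occurs in the phase-point operator `A1 a`. -/
def phaseSign (i : Fin 4) (a : ZMod 2 × ZMod 2) : ℝ :=
  ![1, (-1) ^ a.2.val, (-1) ^ (a.1.val + a.2.val), (-1) ^ a.1.val] i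

/-- The real part of the expectation of `pauli2 i j`. -/
def pauliExp (i j : Fin 4) (σ : Matrix (Fin 4) (Fin 4) ℂ) : ℝ := (pauli2 i j * σ).trace.re

lemma kron2_mul (A B C D : Matrix (Fin 2) (Fin 2) ℂ) :
    kron2 A B * kron2 C D = kron2 (A * C) (B * D) := by
  simp [kron2, Matrix.mul_kronecker_mul, Matrix.submatrix_mul_equiv]

lemma trace_kron2 (A B : Matrix (Fin 2) (Fin 2) ℂ) :
    (kron2 A B).trace = A.trace * B.trace := by
  rw [← Matrix.trace_kronecker]
  simp only [kron2, Matrix.trace, Matrix.diag_apply, Matrix.reindex_apply, Matrix.submatrix_apply]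
  exact Equiv.sum_comp _ fun i => (A ⊗ₖ B) i i

lemma kron2_smul_smul (x y : ℂ) (A B : Matrix (Fin 2) (Fin 2) ℂ) :
    kron2 (x • A) (y • B) = (x * y) • kron2 A B := by
  ext i j
  simp [kron2]
  ring

lemma kron2_one : kron2 1 1 = 1 := by
  simp [kron2]

lemma kron2_sum_sum {ι κ : Type*} (s : Finset ι) (t : Finset κ)
    (A : ι → Matrix (Fin 2) (Fin 2) ℂ) (B : κ → Matrix (Fin 2) (Fin 2) ℂ) :
    kron2 (∑ i ∈ s, A i) (∑ j ∈ t, B j) = ∑ i ∈ s, ∑ j ∈ t, kron2 (A i) (B j) := by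
  ext k l
  simp [kron2, Matrix.sum_apply, Finset.sum_mul_sum]

lemma trace_pauli_mul (i j : Fin 4) :
    (pauli i * pauli j).trace = if i = j then 2 else 0 := by
  fin_cases i <;> fin_cases j <;>
    simp [pauli, PX, PY, PZ, Matrix.trace_fin_two] <;> norm_num

lemma pauli_mul_self (i : Fin 4) : pauli i * pauli i = 1 := by
  fin_cases i <;> ext k l <;> fin_cases k <;> fin_cases l <;>
    simp [pauli, PX, PY, PZ, Matrix.mul_apply, Fin.sum_univ_two]

lemma trace_pauli2_mul (i j k l : Fin 4) :
    (pauli2 i j * pauli2 k l).trace = if i = k ∧ j = l then 4 else 0 := by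
  rw [pauli2, pauli2, kron2_mul, trace_kron2, trace_pauli_mul, trace_pauli_mul]
  by_cases h : i = k <;> by_cases h' : j = l <;> simp [h, h']
  norm_num

lemma pauli2_mul_self (i j : Fin 4) : pauli2 i j * pauli2 i j = 1 := by
  rw [pauli2, kron2_mul, pauli_mul_self, pauli_mul_self, kron2_one]

lemma pauli2_zero_zero : pauli2 0 0 = 1 := by
  simp [pauli2, pauli, kron2_one]

lemma trace_pauli2 (i j : Fin 4) (h : ¬(0 = i ∧ 0 = j)) : (pauli2 i j).trace = 0 := by
  simpa [pauli2_zero_zero, h] using trace_pauli2_mul 0 0 i j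

lemma pauli2_mem (i j : Fin 4) : pauli2 i j ∈ Pauli2 := ⟨0, i, j, by simp [pauli2]⟩

lemma neg_pauli2_mem (i j : Fin 4) : -pauli2 i j ∈ Pauli2 := ⟨2, i, j, by simp [pauli2]⟩

open Classical in
lemma re_trace_pauli2_mul {g : Matrix (Fin 4) (Fin 4) ℂ} (hg : g ∈ Pauli2) (i j : Fin 4) :
    (pauli2 i j * g).trace.re =
      4 * ((if g = pauli2 i j then 1 else 0) - (if g = -pauli2 i j then 1 else 0)) := by
  have hne : pauli2 i j ≠ -pauli2 i j := by
    intro h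
    have h1 := trace_pauli2_mul i j i j
    have h2 := congrArg (fun M => (pauli2 i j * M).trace) h
    simp only [mul_neg, Matrix.trace_neg, h1] at h2
    norm_num at h2
  obtain ⟨k, a, b, hk⟩ := hg
  have hk' : g = Complex.I ^ (k : ℕ) • pauli2 a b := hk
  by_cases hab : i = a ∧ j = b
  · obtain ⟨rfl, rfl⟩ := hab
    have ht := trace_pauli2_mul i j i j
    have hI : ∀ x : ℂ, (x • pauli2 i j = pauli2 i j → x = 1) ∧
        (x • pauli2 i j = -pauli2 i j → x = -1) := by
      intro x
      constructor <;> intro h <;> have h2 := congrArg (fun M => (pauli2 i j * M).trace) h <;>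
        simp [ht] at h2
      · exact h2
      · linear_combination h2 / 4
    obtain ⟨hI1, hI2⟩ := hI (Complex.I ^ (k : ℕ))
    fin_cases k
    · have : g = pauli2 i j := by simp [hk']
      simp [this, ht, hne]
    · have e1 : g ≠ pauli2 i j := fun h => by
        have := congrArg Complex.re (hI1 (hk' ▸ h)); simp at this
      have e2 : g ≠ -pauli2 i j := fun h => by
        have := congrArg Complex.re (hI2 (hk' ▸ h)); simp at this
      rw [if_neg e1, if_neg e2, hk']
      simp [ht]
    · have : g = -pauli2 i j := by simp [hk']
      simp [this, ht, hne.symm]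
    · have e1 : g ≠ pauli2 i j := fun h => by
        have := congrArg Complex.re (hI1 (hk' ▸ h)); simp [pow_succ] at this
      have e2 : g ≠ -pauli2 i j := fun h => by
        have := congrArg Complex.re (hI2 (hk' ▸ h)); simp [pow_succ] at this
      rw [if_neg e1, if_neg e2, hk']
      simp [ht, pow_succ]
  · have h0 : (pauli2 i j * g).trace = 0 := by
      rw [hk', Matrix.mul_smul, Matrix.trace_smul, trace_pauli2_mul, if_neg hab, smul_zero]
    have ht := trace_pauli2_mul i j i j
    have e1 : g ≠ pauli2 i j := by rintro rfl; simp [ht] at h0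
    have e2 : g ≠ -pauli2 i j := by rintro rfl; simp [ht] at h0
    simp [h0, e1, e2]

open Classical in
/-- Pauli expectations of a stabilizer state are read off from its stabilizer group. -/
lemma exists_stabGroup {σ : Matrix (Fin 4) (Fin 4) ℂ} (hσ : σ ∈ Stab2) :
    ∃ S, IsStabGroup2 S ∧ ∀ i j, pauliExp i j σ =
      (if pauli2 i j ∈ S then 1 else 0) - (if -pauli2 i j ∈ S then 1 else 0) := by
  obtain ⟨S, hS, rfl⟩ := hσ
  refine ⟨S, hS, fun i j => ?_⟩
  have h : (4 : ℂ)⁻¹ = ((4⁻¹ : ℝ) : ℂ) := by norm_num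
  rw [pauliExp, Matrix.mul_smul, Matrix.trace_smul, Matrix.mul_sum, Matrix.trace_sum, smul_eq_mul,
    h, Complex.re_ofReal_mul, Complex.re_sum,
    Finset.sum_congr rfl fun g hg => re_trace_pauli2_mul (hS.1 g hg) i j,
    ← Finset.mul_sum, Finset.sum_sub_distrib, Finset.sum_ite_eq', Finset.sum_ite_eq']
  ring

lemma abs_pauliExp_le_one {σ : Matrix (Fin 4) (Fin 4) ℂ} (hσ : σ ∈ Stab2) (i j : Fin 4) :
    |pauliExp i j σ| ≤ 1 := by
  obtain ⟨S, -, h⟩ := exists_stabGroup hσ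
  rw [h]
  split_ifs <;> norm_num

lemma pauliExp_mul_eq_zero {σ : Matrix (Fin 4) (Fin 4) ℂ} (hσ : σ ∈ Stab2) {i j k l : Fin 4}
    (hanti : pauli2 i j * pauli2 k l = -(pauli2 k l * pauli2 i j)) :
    pauliExp i j σ * pauliExp k l σ = 0 := by
  obtain ⟨S, hS, h⟩ := exists_stabGroup hσ
  by_contra hne
  obtain ⟨h1, h2⟩ := mul_ne_zero_iff.mp hne
  have hmem : ∀ a b, pauliExp a b σ ≠ 0 → pauli2 a b ∈ S ∨ -pauli2 a b ∈ S := by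
    intro a b hab
    by_contra! hc
    exact hab (by rw [h]; simp [hc.1, hc.2])
  have hcomm : pauli2 i j * pauli2 k l = pauli2 k l * pauli2 i j := by
    rcases hmem _ _ h1 with ha | ha <;> rcases hmem _ _ h2 with hb | hb <;>
      simpa using (hS.2.2.1 _ ha _ hb).2
  have hz : pauli2 i j * pauli2 k l = 0 := by
    rw [← hcomm] at hanti
    ext a b
    exact self_eq_neg.mp (congrFun₂ hanti a b)
  have h3 : pauli2 i j * (pauli2 i j * pauli2 k l) * pauli2 k l = 1 := by
    rw [← Matrix.mul_assoc, pauli2_mul_self, Matrix.one_mul, pauli2_mul_self]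
  rw [hz] at h3
  simp at h3

/-- The expectation of `(e (ZI + IZ) - (XY + YX)) / 2`. -/
def witness (e : ℝ) (σ : Matrix (Fin 4) (Fin 4) ℂ) : ℝ :=
  (e * (pauliExp 3 0 σ + pauliExp 0 3 σ) - (pauliExp 1 2 σ + pauliExp 2 1 σ)) / 2

lemma PZ_mul_PX : PZ * PX = -(PX * PZ) := by simp [PX, PZ]

lemma PZ_mul_PY : PZ * PY = -(PY * PZ) := by simp [PY, PZ]

lemma kron2_neg_left (A B : Matrix (Fin 2) (Fin 2) ℂ) : kron2 (-A) B = -kron2 A B := by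
  simpa using kron2_smul_smul (-1) 1 A B

lemma kron2_neg_right (A B : Matrix (Fin 2) (Fin 2) ℂ) : kron2 A (-B) = -kron2 A B := by
  simpa using kron2_smul_smul 1 (-1) A B

lemma abs_signed_sub_div_two_le_one {e w x y z : ℝ} (he : e = 1 ∨ e = -1) (hw : |w| ≤ 1)
    (hx : |x| ≤ 1) (hy : |y| ≤ 1) (hz : |z| ≤ 1) (hwy : w * y = 0) (hwz : w * z = 0)
    (hxy : x * y = 0) (hxz : x * z = 0) : |(e * (w + x) - (y + z)) / 2| ≤ 1 := by
  have hor : (w = 0 ∧ x = 0) ∨ (y = 0 ∧ z = 0) := by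
    simp only [mul_eq_zero] at hwy hwz hxy hxz
    tauto
  rw [abs_le] at *
  rcases hor with ⟨rfl, rfl⟩ | ⟨rfl, rfl⟩ <;> rcases he with rfl | rfl <;>
    constructor <;> linarith

lemma abs_witness_le_one {σ : Matrix (Fin 4) (Fin 4) ℂ} (hσ : σ ∈ Stab2) {e : ℝ}
    (he : e = 1 ∨ e = -1) : |witness e σ| ≤ 1 := by
  refine abs_signed_sub_div_two_le_one he (abs_pauliExp_le_one hσ 3 0)
    (abs_pauliExp_le_one hσ 0 3) (abs_pauliExp_le_one hσ 1 2) (abs_pauliExp_le_one hσ 2 1)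
    (pauliExp_mul_eq_zero hσ ?_) (pauliExp_mul_eq_zero hσ ?_)
    (pauliExp_mul_eq_zero hσ ?_) (pauliExp_mul_eq_zero hσ ?_) <;>
  simp [pauli2, kron2_mul, pauli, PZ_mul_PX, PZ_mul_PY, kron2_neg_left, kron2_neg_right]

lemma pauliExp_sum_smul {ι : Type*} (s : Finset ι) (i j : Fin 4) (a : ι → ℝ)
    (σ : ι → Matrix (Fin 4) (Fin 4) ℂ) :
    pauliExp i j (∑ k ∈ s, a k • σ k) = ∑ k ∈ s, a k * pauliExp i j (σ k) := by
  simp [pauliExp, Matrix.mul_sum, Matrix.trace_sum, Matrix.trace_smul]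

lemma witness_sum_smul {ι : Type*} (s : Finset ι) (e : ℝ) (a : ι → ℝ)
    (σ : ι → Matrix (Fin 4) (Fin 4) ℂ) :
    witness e (∑ k ∈ s, a k • σ k) = ∑ k ∈ s, a k * witness e (σ k) := by
  simp only [witness, pauliExp_sum_smul, ← Finset.sum_add_distrib, ← Finset.sum_sub_distrib,
    Finset.mul_sum, Finset.sum_div]
  exact Finset.sum_congr rfl fun k _ => by ring

/-- The operator `(II + ZZ + c (ZI + IZ) - s (XY + YX)) / 4`. -/
def pauliFamily (c s : ℝ) : Matrix (Fin 4) (Fin 4) ℂ :=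
  (4 : ℂ)⁻¹ • (pauli2 0 0 + pauli2 3 3 + (c : ℂ) • (pauli2 3 0 + pauli2 0 3)
    - (s : ℂ) • (pauli2 1 2 + pauli2 2 1))

lemma witness_pauliFamily (e c s : ℝ) : witness e (pauliFamily c s) = e * c + s := by
  have h : (4 : ℂ)⁻¹ = ((4⁻¹ : ℝ) : ℂ) := by norm_num
  simp only [witness, pauliExp, pauliFamily, Matrix.mul_smul, Matrix.mul_add, Matrix.mul_sub,
    Matrix.trace_smul, Matrix.trace_add, Matrix.trace_sub, trace_pauli2_mul, h]
  simp
  ring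

lemma proj_psiRx (θ : ℝ) : proj (psiRx θ) = pauliFamily (Real.cos θ) (Real.sin θ) := by
  obtain ⟨t, rfl⟩ : ∃ t, θ = 2 * t := ⟨θ / 2, by ring⟩
  have hc : Complex.cos (t : ℂ) ^ 2 = 1 - Complex.sin (t : ℂ) ^ 2 := by
    linear_combination Complex.sin_sq_add_cos_sq (t : ℂ)
  have hcos : (starRingEnd ℂ) (Complex.cos (t : ℂ)) = Complex.cos t := by
    rw [← Complex.cos_conj, Complex.conj_ofReal]
  have hsin : (starRingEnd ℂ) (Complex.sin (t : ℂ)) = Complex.sin t := by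
    rw [← Complex.sin_conj, Complex.conj_ofReal]
  ext i j
  fin_cases i <;> fin_cases j <;>
    simp [proj, psiRx, pauliFamily, pauli2, kron2, pauli, PX, PY, PZ, Matrix.vecMulVec_apply,
      Real.cos_two_mul, Real.sin_two_mul, finProdFinEquiv, Fin.divNat, Fin.modNat, hcos, hsin]
  · ring
  · ring
  · ring
  · linear_combination -Complex.sin (t : ℂ) ^ 2 * Complex.I_sq + hc

lemma mem_Stab2_of_generators {g h k : Matrix (Fin 4) (Fin 4) ℂ} (hg : g ∈ Pauli2)
    (hh : h ∈ Pauli2) (hk : k ∈ Pauli2) (hgg : g * g = 1) (hhh : h * h = 1) (hgh : g * h = k)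
    (hhg : h * g = k) (tg : g.trace = 0) (th : h.trace = 0) (tk : k.trace = 0) :
    (4 : ℂ)⁻¹ • (1 + g + h + k) ∈ Stab2 := by
  classical
  have t1 : (1 : Matrix (Fin 4) (Fin 4) ℂ).trace = 4 := by simp
  have hne : ∀ m : Matrix (Fin 4) (Fin 4) ℂ, m.trace = 0 → 1 ≠ m ∧ -1 ≠ m := by
    intro m hm
    constructor <;> rintro rfl <;> simp at hm
  have hgk : g * k = h := by rw [← hgh, ← Matrix.mul_assoc, hgg, Matrix.one_mul]
  have hhk : h * k = g := by rw [← hhg, ← Matrix.mul_assoc, hhh, Matrix.one_mul]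
  have hkg : k * g = h := by rw [← hhg, Matrix.mul_assoc, hgg, Matrix.mul_one]
  have hkh : k * h = g := by rw [← hgh, Matrix.mul_assoc, hhh, Matrix.mul_one]
  have hkk : k * k = 1 := by
    nth_rewrite 1 [← hgh]
    rw [Matrix.mul_assoc, hhk, hgg]
  have n1 : g ≠ h := by rintro rfl; exact (hne k tk).1 (hgg.symm.trans hgh)
  have n2 : g ≠ k := by rintro rfl; exact (hne h th).1 (hgg.symm.trans hgk)
  have n3 : h ≠ k := by rintro rfl; exact (hne g tg).1 (hhh.symm.trans hhk)
  have p1 : (1 : Matrix (Fin 4) (Fin 4) ℂ) ∈ Pauli2 := pauli2_zero_zero ▸ pauli2_mem 0 0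
  refine ⟨{1, g, h, k}, ⟨?_, by simp, ?_, ?_, ?_⟩, ?_⟩
  · simp [p1, hg, hh, hk]
  · simp [hgg, hhh, hgh, hhg, hgk, hkg, hhk, hkh, hkk]
  · rw [Finset.card_insert_of_notMem, Finset.card_insert_of_notMem, Finset.card_pair n3]
    · simp [n1, n2]
    · simp [(hne g tg).1, (hne h th).1, (hne k tk).1]
  · have : (-1 : Matrix (Fin 4) (Fin 4) ℂ) ≠ 1 := by
      intro h
      have := congrArg Matrix.trace h
      simp at this
      norm_num at this
    simp [(hne g tg).2, (hne h th).2, (hne k tk).2, this]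
  · rw [Finset.sum_insert, Finset.sum_insert, Finset.sum_insert, Finset.sum_singleton]
    · simp only [add_assoc]
    · simpa using n3
    · simp [n1, n2]
    · simp [(hne g tg).1, (hne h th).1, (hne k tk).1]

lemma PX_mul_PY : PX * PY = Complex.I • PZ := by simp [PX, PY, PZ]

lemma PY_mul_PX : PY * PX = -(Complex.I • PZ) := by simp [PX, PY, PZ]

lemma pauli2_mul_XY_YX : pauli2 1 2 * pauli2 2 1 = pauli2 3 3 := by
  simp [pauli2, kron2_mul, pauli, PX_mul_PY, PY_mul_PX, ← neg_smul, kron2_smul_smul]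

lemma pauli2_mul_YX_XY : pauli2 2 1 * pauli2 1 2 = pauli2 3 3 := by
  simp [pauli2, kron2_mul, pauli, PX_mul_PY, PY_mul_PX, ← neg_smul, kron2_smul_smul]

lemma pauli2_mul_ZI_IZ : pauli2 3 0 * pauli2 0 3 = pauli2 3 3 := by
  simp [pauli2, kron2_mul, pauli]

lemma pauli2_mul_IZ_ZI : pauli2 0 3 * pauli2 3 0 = pauli2 3 3 := by
  simp [pauli2, kron2_mul, pauli]

lemma pauliFamily_sign_zero_mem {e : ℝ} (he : e = 1 ∨ e = -1) : pauliFamily e 0 ∈ Stab2 := by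
  rcases he with rfl | rfl
  · convert mem_Stab2_of_generators (pauli2_mem 3 0) (pauli2_mem 0 3) (pauli2_mem 3 3)
      (pauli2_mul_self _ _) (pauli2_mul_self _ _) pauli2_mul_ZI_IZ pauli2_mul_IZ_ZI
      (trace_pauli2 _ _ (by decide)) (trace_pauli2 _ _ (by decide))
      (trace_pauli2 _ _ (by decide)) using 1
    simp [pauliFamily, pauli2_zero_zero]
    module
  · convert mem_Stab2_of_generators (neg_pauli2_mem 3 0) (neg_pauli2_mem 0 3) (pauli2_mem 3 3)
      (by rw [neg_mul_neg, pauli2_mul_self]) (by rw [neg_mul_neg, pauli2_mul_self])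
      (by rw [neg_mul_neg, pauli2_mul_ZI_IZ]) (by rw [neg_mul_neg, pauli2_mul_IZ_ZI])
      (by rw [Matrix.trace_neg, trace_pauli2 _ _ (by decide), neg_zero])
      (by rw [Matrix.trace_neg, trace_pauli2 _ _ (by decide), neg_zero])
      (trace_pauli2 _ _ (by decide)) using 1
    simp [pauliFamily, pauli2_zero_zero]
    module

lemma pauliFamily_zero_sign_mem {e : ℝ} (he : e = 1 ∨ e = -1) : pauliFamily 0 e ∈ Stab2 := by
  rcases he with rfl | rfl
  · convert mem_Stab2_of_generators (neg_pauli2_mem 1 2) (neg_pauli2_mem 2 1) (pauli2_mem 3 3)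
      (by rw [neg_mul_neg, pauli2_mul_self]) (by rw [neg_mul_neg, pauli2_mul_self])
      (by rw [neg_mul_neg, pauli2_mul_XY_YX]) (by rw [neg_mul_neg, pauli2_mul_YX_XY])
      (by rw [Matrix.trace_neg, trace_pauli2 _ _ (by decide), neg_zero])
      (by rw [Matrix.trace_neg, trace_pauli2 _ _ (by decide), neg_zero])
      (trace_pauli2 _ _ (by decide)) using 1
    simp [pauliFamily, pauli2_zero_zero]
    module
  · convert mem_Stab2_of_generators (pauli2_mem 1 2) (pauli2_mem 2 1) (pauli2_mem 3 3)
      (pauli2_mul_self _ _) (pauli2_mul_self _ _) pauli2_mul_XY_YX pauli2_mul_YX_XY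
      (trace_pauli2 _ _ (by decide)) (trace_pauli2 _ _ (by decide))
      (trace_pauli2 _ _ (by decide)) using 1
    simp [pauliFamily, pauli2_zero_zero]
    module

lemma Gam2_pauliFamily {e c s : ℝ} (he : e = 1 ∨ e = -1) (h : 1 ≤ e * c + s) (hc : 0 ≤ e * c)
    (hc1 : e * c ≤ 1) : Gam2 (pauliFamily c s) = e * c + s := by
  refine IsLeast.csInf_eq ⟨?_, ?_⟩
  · refine ⟨3, ![e * c, (1 - e * c + s) / 2, (1 - e * c - s) / 2],
      ![pauliFamily e 0, pauliFamily 0 1, pauliFamily 0 (-1)], ?_, ?_, ?_⟩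
    · intro i
      fin_cases i
      · exact pauliFamily_sign_zero_mem he
      · exact pauliFamily_zero_sign_mem (Or.inl rfl)
      · exact pauliFamily_zero_sign_mem (Or.inr rfl)
    · ext i j
      simp [Fin.sum_univ_three, pauliFamily]
      rcases he with rfl | rfl <;> push_cast <;> ring
    · simp only [Fin.sum_univ_three, Matrix.cons_val]
      rw [abs_of_nonneg hc, abs_of_nonneg (by linarith), abs_of_nonpos (by linarith)]
      ring
  · rintro t ⟨k, a, σ, hσ, hρ, rfl⟩
    rw [← witness_pauliFamily, hρ, witness_sum_smul]
    refine Finset.sum_le_sum fun i _ => (le_abs_self _).trans ?_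
    rw [abs_mul]
    exact mul_le_of_le_one_right (abs_nonneg _) (abs_witness_le_one (hσ i) he)

lemma sum_zmod_two {M : Type*} [AddCommMonoid M] (f : ZMod 2 → M) : ∑ a, f a = f 0 + f 1 :=
  Fin.sum_univ_two f

lemma sum_phaseSign_smul_A1 (i : Fin 4) :
    ∑ a, (phaseSign i a : ℂ) • A1 a = (2 : ℂ) • pauli i := by
  have h1 : (1 : ZMod 2).val = 1 := rfl
  have h0 : (0 : ZMod 2).val = 0 := rfl
  rw [Fintype.sum_prod_type]
  simp only [sum_zmod_two]
  fin_cases i <;> simp [phaseSign, A1, pauli, h0, h1] <;> module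

lemma trace_pauli_mul_A1 (i : Fin 4) (a : ZMod 2 × ZMod 2) :
    (pauli i * A1 a).trace = phaseSign i a := by
  have h : A1 a = ∑ j, ((phaseSign j a / 2 : ℝ) : ℂ) • pauli j := by
    simp [Fin.sum_univ_four, A1, pauli, phaseSign]
    module
  simp [h, Matrix.mul_sum, Matrix.trace_sum, Matrix.trace_smul, trace_pauli_mul]

lemma sum_phaseSign_mul_W2 (i j : Fin 4) (σ : Matrix (Fin 4) (Fin 4) ℂ) :
    ∑ α, phaseSign i α.1 * phaseSign j α.2 * W2 σ α = pauliExp i j σ := by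
  have h : ∑ α : (ZMod 2 × ZMod 2) × (ZMod 2 × ZMod 2),
      ((phaseSign i α.1 * phaseSign j α.2 : ℝ) : ℂ) • A2 α = (4 : ℂ) • pauli2 i j := by
    have h2 := kron2_sum_sum Finset.univ Finset.univ
      (fun a => (phaseSign i a : ℂ) • A1 a) (fun a => (phaseSign j a : ℂ) • A1 a)
    rw [sum_phaseSign_smul_A1, sum_phaseSign_smul_A1] at h2
    simp only [kron2_smul_smul] at h2
    rw [Fintype.sum_prod_type]
    simp only [A2, pauli2, Complex.ofReal_mul]
    rw [← h2]
    norm_num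
  have h3 : (4 : ℂ)⁻¹ * (σ * ((4 : ℂ) • pauli2 i j)).trace = (pauli2 i j * σ).trace := by
    rw [Matrix.mul_smul, Matrix.trace_smul, Matrix.trace_mul_comm, smul_eq_mul]
    ring
  rw [pauliExp, ← h3, ← h, Matrix.mul_sum, Matrix.trace_sum, Finset.mul_sum, Complex.re_sum]
  refine Finset.sum_congr rfl fun α _ => ?_
  rw [W2, Matrix.mul_smul, Matrix.trace_smul, smul_eq_mul, mul_left_comm, Complex.re_ofReal_mul]

/-- The phase-space symbol of `witness e`. -/
def witnessSymbol (e : ℝ) (α : (ZMod 2 × ZMod 2) × (ZMod 2 × ZMod 2)) : ℝ :=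
  (e * (phaseSign 3 α.1 * phaseSign 0 α.2 + phaseSign 0 α.1 * phaseSign 3 α.2)
    - (phaseSign 1 α.1 * phaseSign 2 α.2 + phaseSign 2 α.1 * phaseSign 1 α.2)) / 2

lemma sum_witnessSymbol_mul_W2 (e : ℝ) (σ : Matrix (Fin 4) (Fin 4) ℂ) :
    ∑ α, witnessSymbol e α * W2 σ α = witness e σ := by
  simp only [witness, ← sum_phaseSign_mul_W2, ← Finset.sum_add_distrib,
    ← Finset.sum_sub_distrib, Finset.mul_sum, Finset.sum_div]
  exact Finset.sum_congr rfl fun α _ => by rw [witnessSymbol]; ring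

lemma abs_phaseSign (i : Fin 4) (a : ZMod 2 × ZMod 2) : |phaseSign i a| = 1 := by
  fin_cases i <;> simp [phaseSign]

lemma abs_witnessSymbol_le {e : ℝ} (he : e = 1 ∨ e = -1)
    (α : (ZMod 2 × ZMod 2) × (ZMod 2 × ZMod 2)) : |witnessSymbol e α| ≤ 2 := by
  have hb : ∀ i j, |phaseSign i α.1 * phaseSign j α.2| ≤ 1 := fun i j => by
    rw [abs_mul, abs_phaseSign, abs_phaseSign, one_mul]
  have b1 := abs_le.mp (hb 3 0)
  have b2 := abs_le.mp (hb 0 3)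
  have b3 := abs_le.mp (hb 1 2)
  have b4 := abs_le.mp (hb 2 1)
  rw [witnessSymbol, abs_le]
  rcases he with rfl | rfl <;> constructor <;> linarith

lemma sum_abs_witnessSymbol {e : ℝ} (he : e = 1 ∨ e = -1) : ∑ α, |witnessSymbol e α| = 8 := by
  have h1 : (1 : ZMod 2).val = 1 := rfl
  have h0 : (0 : ZMod 2).val = 0 := rfl
  simp only [Fintype.sum_prod_type, sum_zmod_two, witnessSymbol, phaseSign, Matrix.cons_val, h0, h1]
  rcases he with rfl | rfl <;> norm_num

lemma sum_witnessSymbol_mul_le_one {e : ℝ} (he : e = 1 ∨ e = -1)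
    {f : (ZMod 2 × ZMod 2) × (ZMod 2 × ZMod 2) → ℝ} (hf : f ∈ WFree2) :
    ∑ α, witnessSymbol e α * f α ≤ 1 := by
  have hlin : IsLinearMap ℝ fun f : (ZMod 2 × ZMod 2) × (ZMod 2 × ZMod 2) → ℝ =>
      ∑ α, witnessSymbol e α * f α :=
    ⟨fun x y => by simp [mul_add, Finset.sum_add_distrib],
      fun r x => by simp [Finset.mul_sum, mul_left_comm]⟩
  refine convexHull_min ?_ (convex_halfSpace_le hlin 1) hf
  rintro w ⟨σ, hσ, rfl⟩
  simp only [Set.mem_ofPred_eq, sum_witnessSymbol_mul_W2]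
  exact (le_abs_self _).trans (abs_witness_le_one hσ he)

lemma trace_pauli2_mul_A2 (i j : Fin 4) (α : (ZMod 2 × ZMod 2) × (ZMod 2 × ZMod 2)) :
    (pauli2 i j * A2 α).trace = ((phaseSign i α.1 * phaseSign j α.2 : ℝ) : ℂ) := by
  rw [pauli2, A2, kron2_mul, trace_kron2, trace_pauli_mul_A1, trace_pauli_mul_A1,
    Complex.ofReal_mul]

lemma W2_pauliFamily (c s : ℝ) (α : (ZMod 2 × ZMod 2) × (ZMod 2 × ZMod 2)) :
    W2 (pauliFamily c s) α =
      (phaseSign 0 α.1 * phaseSign 0 α.2 + phaseSign 3 α.1 * phaseSign 3 α.2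
        + c * (phaseSign 3 α.1 * phaseSign 0 α.2 + phaseSign 0 α.1 * phaseSign 3 α.2)
        - s * (phaseSign 1 α.1 * phaseSign 2 α.2 + phaseSign 2 α.1 * phaseSign 1 α.2)) / 16 := by
  have h : (4 : ℂ)⁻¹ = ((4⁻¹ : ℝ) : ℂ) := by norm_num
  simp only [W2, pauliFamily, Matrix.smul_mul, Matrix.add_mul, Matrix.sub_mul,
    Matrix.trace_smul, Matrix.trace_add, Matrix.trace_sub, trace_pauli2_mul_A2, h, smul_eq_mul,
    ← Complex.ofReal_mul, ← Complex.ofReal_add, ← Complex.ofReal_sub, Complex.ofReal_re]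
  ring

lemma C2_pauliFamily {e c s : ℝ} (he : e = 1 ∨ e = -1) (h : 1 ≤ e * c + s)
    (hc1 : e * c ≤ 1) (hs1 : s ≤ 1) :
    C2 (pauliFamily c s) = 1 / 2 * (e * c + s - 1) := by
  refine IsLeast.csInf_eq ⟨?_, ?_⟩
  · set p : ℝ := (1 + e * c - s) / 2 with hp
    set q : ℝ := (1 - e * c + s) / 2 with hq
    have hW : ∀ σ ∈ Stab2, W2 σ ∈ WFree2 := fun σ hσ => subset_convexHull ℝ _ ⟨σ, hσ, rfl⟩
    have hmem : p • W2 (pauliFamily e 0) + q • W2 (pauliFamily 0 1) ∈ WFree2 :=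
      convex_convexHull ℝ _ (hW _ (pauliFamily_sign_zero_mem he))
        (hW _ (pauliFamily_zero_sign_mem (Or.inl rfl)))
        (by linarith) (by linarith) (by linarith)
    refine ⟨_, hmem, ?_⟩
    have hdiff : ∀ α, |W2 (pauliFamily c s) α
        - (p • W2 (pauliFamily e 0) + q • W2 (pauliFamily 0 1)) α|
        = (e * c + s - 1) / 16 * |witnessSymbol e α| := by
      intro α
      rw [← abs_of_nonneg (show 0 ≤ (e * c + s - 1) / 16 by linarith), ← abs_mul]
      congr 1
      simp only [Pi.add_apply, Pi.smul_apply, smul_eq_mul, W2_pauliFamily, witnessSymbol, hp, hq]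
      rcases he with rfl | rfl <;> ring
    simp only [hdiff]
    rw [← Finset.mul_sum, sum_abs_witnessSymbol he]
    ring
  · rintro d ⟨f, hf, rfl⟩
    have h1 := sum_witnessSymbol_mul_le_one he hf
    have h2 := sum_witnessSymbol_mul_W2 e (pauliFamily c s)
    rw [witness_pauliFamily] at h2
    have h3 : ∑ α, witnessSymbol e α * (W2 (pauliFamily c s) α - f α) ≤
        ∑ α, 2 * |W2 (pauliFamily c s) α - f α| := by
      refine Finset.sum_le_sum fun α _ => (le_abs_self _).trans ?_
      rw [abs_mul]
      exact mul_le_mul_of_nonneg_right (abs_witnessSymbol_le he α) (abs_nonneg _)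
    simp only [mul_sub, Finset.sum_sub_distrib] at h3
    rw [← Finset.mul_sum] at h3
    linarith

/-- exact values for the R_x family:
`C = (1/2)(|sin θ| + |cos θ| − 1)`, `Γ = |sin θ| + |cos θ|`, hence `κ = 2`. -/
theorem kappa_Rx (θ : ℝ) (h0 : 0 < θ) (hπ : θ < Real.pi) :
    C2 (proj (psiRx θ)) = (1 / 2) * (|Real.sin θ| + |Real.cos θ| - 1) ∧
    Gam2 (proj (psiRx θ)) = |Real.sin θ| + |Real.cos θ| ∧
    Gam2 (proj (psiRx θ)) - 1 = 2 * C2 (proj (psiRx θ)) ∧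
    (0 < C2 (proj (psiRx θ)) →
      (Gam2 (proj (psiRx θ)) - 1) / C2 (proj (psiRx θ)) = 2) := by
  have hs : 0 < Real.sin θ := Real.sin_pos_of_pos_of_lt_pi h0 hπ
  obtain ⟨e, he, hec⟩ : ∃ e : ℝ, (e = 1 ∨ e = -1) ∧ |Real.cos θ| = e * Real.cos θ := by
    rcases abs_choice (Real.cos θ) with h | h
    · exact ⟨1, Or.inl rfl, by rw [h, one_mul]⟩
    · exact ⟨-1, Or.inr rfl, by rw [h, neg_one_mul]⟩
  have hc0 : 0 ≤ e * Real.cos θ := hec ▸ abs_nonneg _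
  have hc1 : e * Real.cos θ ≤ 1 := hec ▸ Real.abs_cos_le_one θ
  have hs1 := Real.sin_le_one θ
  have hsum : 1 ≤ e * Real.cos θ + Real.sin θ := by
    have hsq : (e * Real.cos θ) ^ 2 = Real.cos θ ^ 2 := by rw [← hec, sq_abs]
    nlinarith [Real.sin_sq_add_cos_sq θ, mul_nonneg hc0 hs.le]
  have hC : C2 (proj (psiRx θ)) = (1 / 2) * (|Real.sin θ| + |Real.cos θ| - 1) := by
    rw [proj_psiRx, C2_pauliFamily he hsum hc1 hs1, hec, abs_of_pos hs]
    ring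
  have hG : Gam2 (proj (psiRx θ)) = |Real.sin θ| + |Real.cos θ| := by
    rw [proj_psiRx, Gam2_pauliFamily he hsum hc0 hc1, hec, abs_of_pos hs]
    ring
  have hGC : Gam2 (proj (psiRx θ)) - 1 = 2 * C2 (proj (psiRx θ)) := by
    rw [hC, hG]
    ring
  refine ⟨hC, hG, hGC, fun hpos => ?_⟩
  rw [hGC, mul_div_cancel_right₀ _ hpos.ne']
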